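/- arXiv:1902.02745 — 2 statements merged into one kernel-verified Lean document; each statement's English description precedes it below -/
import Mathlib

section
/- Let ω : [0,∞) → [0,∞) be a continuous increasing function such that φ(t) := ω(e^t) is convex, and suppose there exist a ∈ ℝ and b > 0 with ω(t) ≥ a + b·log(1+t) for all t ≥ 0. Let φ*(s) := sup_{t≥0}(ts − φ(t)). Then for all σ, λ > 0 and all t ≥ 1: inf_{j∈ℕ₀} t^{−σj} e^{λφ*(σj/λ)} ≤ e^{−(λ − σ/b)ω(t) − aσ/b}. -/
open MeasureTheory Real Filter Topology
open scoped ENNReal NNReal BigOperators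

noncomputable section

/-- Young conjugate of `φ(t) = ω(eᵗ)`, i.e. `φ*(s) = sup_{t ≥ 0} (t s - φ(t))`,
as an extended real number. -/
def youngStar (ω : ℝ → ℝ) (s : ℝ) : EReal :=
  ⨆ t : Set.Ici (0:ℝ), (((t : ℝ) * s - ω (Real.exp t) : ℝ) : EReal)

/-- Exponential of an extended real number, valued in `[0,∞]`. -/
def expE (x : EReal) : ℝ≥0∞ :=
  if x = ⊤ then ⊤ else if x = ⊥ then 0 else ENNReal.ofReal (Real.exp x.toReal)

/-- A convex function on the real line has a supporting line at every point. -/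
theorem ConvexOn.exists_supporting_line {f : ℝ → ℝ} (hf : ConvexOn ℝ Set.univ f) (x : ℝ) :
    ∃ m : ℝ, ∀ u, f x + m * (u - x) ≤ f u := by
  have hint : ∀ y : ℝ, y ∈ interior (Set.univ : Set ℝ) := by simp
  refine ⟨derivWithin f (Set.Ioi x) x, fun u => ?_⟩
  rcases lt_trichotomy u x with h | rfl | h
  · have h1 := (hf.slope_le_leftDeriv_of_mem_interior (Set.mem_univ u) (hint x) h).trans
      (hf.leftDeriv_le_rightDeriv_of_mem_interior (hint x))
    rw [slope_def_field, div_le_iff₀ (sub_pos.2 h)] at h1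
    linarith
  · simp
  · have h1 := hf.rightDeriv_le_slope_of_mem_interior (hint x) (Set.mem_univ u) h
    rw [slope_def_field, le_div_iff₀ (sub_pos.2 h)] at h1
    linarith

/-- If `φ(t) = ω(eᵗ)` lies above the line of slope `m` through `(x, φ(x))`, then
`φ*(s) ≤ m x - φ(x)` for all `s ≤ m`. -/
theorem youngStar_le_of_supporting_line {ω : ℝ → ℝ} {x m s : ℝ} (hs : s ≤ m)
    (hm : ∀ u, ω (Real.exp x) + m * (u - x) ≤ ω (Real.exp u)) :
    youngStar ω s ≤ ((m * x - ω (Real.exp x) : ℝ) : EReal) := by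
  refine iSup_le fun u => EReal.coe_le_coe_iff.2 ?_
  have h1 := hm u
  have h2 := mul_le_mul_of_nonneg_left hs (Set.mem_Ici.1 u.2)
  linarith

theorem youngStar_ne_bot (ω : ℝ → ℝ) (s : ℝ) : youngStar ω s ≠ ⊥ :=
  ne_bot_of_le_ne_bot (EReal.coe_ne_bot _)
    (le_iSup (fun t : Set.Ici (0 : ℝ) => (((t : ℝ) * s - ω (Real.exp t) : ℝ) : EReal))
      ⟨0, Set.mem_Ici.2 le_rfl⟩)

theorem expE_coe (r : ℝ) : expE (r : EReal) = ENNReal.ofReal (Real.exp r) := by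
  simp [expE]

/-- if moreover `ω(t) ≥ a + b log(1+t)` for all `t ≥ 0` (with `b > 0`),
then for all `σ, λ > 0` and `t ≥ 1`:
`inf_{j ∈ ℕ₀} t^{-σ j} e^{λ φ*(σ j / λ)} ≤ e^{-(λ - σ/b) ω(t) - a σ / b}`. -/
theorem statement1 (ω : ℝ → ℝ) (a b : ℝ) (hb : 0 < b)
    (hcont : ContinuousOn ω (Set.Ici 0))
    (hmono : MonotoneOn ω (Set.Ici 0))
    (hnonneg : ∀ t, 0 ≤ t → 0 ≤ ω t)
    (hconv : ConvexOn ℝ Set.univ (fun t => ω (Real.exp t)))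
    (hgamma : ∀ t, 0 ≤ t → a + b * Real.log (1 + t) ≤ ω t)
    (σ lam : ℝ) (hσ : 0 < σ) (hlam : 0 < lam) (t : ℝ) (ht : 1 ≤ t) :
    (⨅ j : ℕ, ENNReal.ofReal (t ^ (-(σ * (j : ℝ)))) *
        expE ((lam : EReal) * youngStar ω (σ * (j : ℝ) / lam)))
      ≤ ENNReal.ofReal (Real.exp (-(lam - σ / b) * ω t - a * σ / b)) := by
  obtain ⟨x, rfl⟩ : ∃ x, Real.exp x = t := ⟨Real.log t, Real.exp_log (by linarith)⟩
  have hx : 0 ≤ x := Real.one_le_exp_iff.1 ht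
  obtain ⟨m, hm⟩ := hconv.exists_supporting_line x
  have hm0 : 0 ≤ m := by
    have h1 := hm (x - 1)
    have h2 : ω (Real.exp (x - 1)) ≤ ω (Real.exp x) :=
      hmono (Real.exp_pos _).le (Real.exp_pos _).le (Real.exp_le_exp.2 (by linarith))
    linarith
  have hxω : x ≤ (ω (Real.exp x) - a) / b := by
    have h1 : x ≤ Real.log (1 + Real.exp x) := by
      rw [Real.le_log_iff_exp_le (by positivity)]
      linarith
    have h2 := hgamma (Real.exp x) (Real.exp_pos x).le
    rw [le_div_iff₀ hb]
    nlinarith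
  set j : ℕ := ⌊lam * m / σ⌋₊
  have hj : σ * j ≤ lam * m := by
    have := Nat.floor_le (div_nonneg (mul_nonneg hlam.le hm0) hσ.le)
    rwa [le_div_iff₀ hσ, mul_comm] at this
  have hj' : lam * m ≤ σ * j + σ := by
    have := (Nat.lt_floor_add_one (lam * m / σ)).le
    rw [div_le_iff₀ hσ] at this
    linarith
  have hs : σ * j / lam ≤ m := by
    rw [div_le_iff₀ hlam]
    linarith
  have hle := youngStar_le_of_supporting_line hs hm
  refine (iInf_le _ j).trans ?_
  lift youngStar ω (σ * j / lam) to ℝ using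
    ⟨ne_top_of_le_ne_top (EReal.coe_ne_top _) hle, youngStar_ne_bot _ _⟩ with r
  rw [EReal.coe_le_coe_iff] at hle
  rw [← EReal.coe_mul, expE_coe, ← ENNReal.ofReal_mul (by positivity), ← Real.exp_mul,
    ← Real.exp_add]
  refine ENNReal.ofReal_le_ofReal (Real.exp_le_exp.2 ?_)
  calc x * -(σ * j) + lam * r
      ≤ x * -(σ * j) + lam * (m * x - ω (Real.exp x)) := by gcongr
    _ = x * (lam * m - σ * j) - lam * ω (Real.exp x) := by ring
    _ ≤ x * σ - lam * ω (Real.exp x) := by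
      gcongr
      linarith
    _ ≤ (ω (Real.exp x) - a) / b * σ - lam * ω (Real.exp x) := by gcongr
    _ = -(lam - σ / b) * ω (Real.exp x) - a * σ / b := by ring

end
end

section
/- Let P ∈ ℂ[ξ₁,…,ξ_d] be a polynomial of degree m ≥ 1. Then for every multi-index k there exist polynomials P_{ℓ,k} ∈ ℂ[ξ₁,…,ξ_d] for ℓ = 0,…,|k|, independent of n and with deg P_{ℓ,k} ≤ ℓ(m−1), such that for every n ≥ |k|: ∂^k (P^n) = Σ_{ℓ=0}^{|k|} (n!/(n−ℓ)!) · P_{ℓ,k} · P^{n−ℓ} (with ∂^k the iterated partial derivative of polynomials). -/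
open scoped BigOperators

noncomputable section

/-- Iterated formal partial derivative `∂^k` of a multivariate polynomial. -/
def mpd {d : ℕ} (k : Fin d → ℕ) (P : MvPolynomial (Fin d) ℂ) : MvPolynomial (Fin d) ℂ :=
  (((List.finRange d).flatMap fun i => List.replicate (k i) i)).foldr
    (fun i Q => MvPolynomial.pderiv i Q) P

theorem MvPolynomial.totalDegree_pderiv_le_sub_one {σ R : Type*} [CommSemiring R] (i : σ)
    (p : MvPolynomial σ R) : (pderiv i p).totalDegree ≤ p.totalDegree - 1 := by
  refine Finset.sup_le fun s hs => ?_
  have hcoeff : s + Finsupp.single i 1 ∈ p.support := by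
    rw [mem_support_iff, coeff_pderiv] at hs
    exact mem_support_iff.2 (left_ne_zero_of_mul hs)
  have hle := le_totalDegree hcoeff
  rw [Finsupp.sum_add_index' (fun _ => rfl) (fun _ _ _ => rfl),
    Finsupp.sum_single_index rfl] at hle
  omega

/-- An iterated partial derivative of `P ^ n` expands in powers of `P` with falling factorial
weights and coefficients that do not depend on `n`. -/
theorem MvPolynomial.exists_foldr_pderiv_pow_eq {σ R : Type*} [CommSemiring R]
    (P : MvPolynomial σ R) (L : List σ) :
    ∃ Q : ℕ → MvPolynomial σ R,
      (∀ l, (Q l).totalDegree ≤ l * (P.totalDegree - 1)) ∧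
      (∀ l, L.length < l → Q l = 0) ∧
      ∀ n : ℕ, L.foldr (fun i q => pderiv i q) (P ^ n) =
        ∑ l ∈ Finset.range (L.length + 1),
          (n.descFactorial l : MvPolynomial σ R) * Q l * P ^ (n - l) := by
  induction L with
  | nil =>
    refine ⟨fun l => if l = 0 then 1 else 0, fun l => ?_, fun l hl => ?_, fun n => ?_⟩
    · dsimp only
      split_ifs <;> simp
    · exact if_neg (by simpa using hl.ne')
    · simp
  | cons i L ih =>
    obtain ⟨Q, hdeg, hzero, hQ⟩ := ih
    refine ⟨fun l => pderiv i (Q l) + (match l with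
      | 0 => 0
      | l + 1 => Q l * pderiv i P), fun l => ?_, fun l hl => ?_, fun n => ?_⟩
    · have hd : (pderiv i (Q l)).totalDegree ≤ l * (P.totalDegree - 1) :=
        ((totalDegree_pderiv_le_sub_one i (Q l)).trans (Nat.sub_le _ _)).trans (hdeg l)
      cases l with
      | zero => simpa using hd
      | succ l =>
        refine (totalDegree_add _ _).trans (max_le hd ((totalDegree_mul _ _).trans ?_))
        rw [Nat.succ_mul]
        exact add_le_add (hdeg l) (totalDegree_pderiv_le_sub_one i P)
    · cases l with
      | zero => simp at hl
      | succ l =>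
        rw [List.length_cons] at hl
        simp [hzero l (by omega), hzero (l + 1) (by omega)]
    · have hterm : ∀ l, pderiv i ((n.descFactorial l : MvPolynomial σ R) * Q l * P ^ (n - l)) =
          (n.descFactorial l : MvPolynomial σ R) * pderiv i (Q l) * P ^ (n - l) +
          (n.descFactorial (l + 1) : MvPolynomial σ R) * (Q l * pderiv i P) *
            P ^ (n - (l + 1)) := by
        intro l
        rw [pderiv_mul, pderiv_mul, pderiv_pow, Derivation.map_natCast, Nat.descFactorial_succ,
          Nat.sub_sub]
        push_cast
        ring
      rw [List.foldr_cons, hQ, map_sum, Finset.sum_congr rfl fun l _ => hterm l,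
        Finset.sum_add_distrib, List.length_cons]
      simp only [mul_add, add_mul]
      rw [Finset.sum_add_distrib]
      congr 1
      · rw [Finset.sum_range_succ _ (L.length + 1), hzero (L.length + 1) (Nat.lt_succ_self _)]
        simp
      · rw [Finset.sum_range_succ' _ (L.length + 1)]
        simp

/-- let `P ∈ ℂ[ξ₁,…,ξ_d]` have degree `m ≥ 1`. For every multi-index `k`
there are polynomials `P_{ℓ,k}` (for `ℓ = 0,…,|k|`), independent of `n`, with
`deg P_{ℓ,k} ≤ ℓ(m-1)`, such that for every `n ≥ |k|`:
`∂^k (P^n) = ∑_{ℓ=0}^{|k|} (n!/(n-ℓ)!) P_{ℓ,k} P^{n-ℓ}`. -/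
theorem statement17 (d m : ℕ) (hm : 1 ≤ m)
    (P : MvPolynomial (Fin d) ℂ) (hdeg : P.totalDegree = m)
    (k : Fin d → ℕ) :
    ∃ Q : ℕ → MvPolynomial (Fin d) ℂ,
      (∀ ℓ ≤ ∑ i, k i, (Q ℓ).totalDegree ≤ ℓ * (m - 1)) ∧
      ∀ n : ℕ, ∑ i, k i ≤ n →
        mpd k (P ^ n) =
          ∑ ℓ ∈ Finset.range ((∑ i, k i) + 1),
            MvPolynomial.C (((n.factorial / (n - ℓ).factorial : ℕ)) : ℂ) *
              Q ℓ * P ^ (n - ℓ) := by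
  obtain ⟨Q, hQdeg, -, hQ⟩ := MvPolynomial.exists_foldr_pderiv_pow_eq P
    ((List.finRange d).flatMap fun i => List.replicate (k i) i)
  have hlen : ((List.finRange d).flatMap fun i => List.replicate (k i) i).length = ∑ i, k i := by
    simp [List.length_flatMap, Fin.sum_univ_def]
  rw [hlen] at hQ
  refine ⟨Q, fun l _ => hdeg ▸ hQdeg l, fun n hn => (hQ n).trans ?_⟩
  refine Finset.sum_congr rfl fun l hl => ?_
  rw [Finset.mem_range] at hl
  rw [Nat.descFactorial_eq_div (by omega), map_natCast]

end
end
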